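/- Let p ∈ (1/4, 1) be a real number. There exists an integer N (depending only on p) such that for all integers n ≥ N and m with 1 ≤ m ≤ n, and every integer t with t ≥ 1 and |t − log_p(m/n)| ≤ 1/2, the following holds: for every subset f of [n] with |f| = t − 1, the probability under G(n,p) that f is NOT a face of N_m(G) (i.e., that f has fewer than m common neighbors) is at most exp(−(1/3)(p^{−1/2} − 1)² · m²/n). -/

import Mathlib

open MeasureTheory

/-- Configuration of edge indicators for a graph on vertex set `Fin n`. -/
abbrev EdgeCfg (n : ℕ) := {e : Sym2 (Fin n) // ¬ e.IsDiag} → Bool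

/-- Bernoulli measure on `Bool` with success probability `p`. -/
noncomputable def bern (p : ℝ) : Measure Bool :=
  ENNReal.ofReal p • Measure.dirac true + ENNReal.ofReal (1 - p) • Measure.dirac false

/-- The Erdős–Rényi measure `G(n,p)`: edge indicators are i.i.d. Bernoulli(p). -/
noncomputable def erdosRenyi (n : ℕ) (p : ℝ) : Measure (EdgeCfg n) :=
  Measure.pi fun _ => bern p

/-- `u` and `v` are adjacent in the graph encoded by `ω`. -/
def Adj {n : ℕ} (ω : EdgeCfg n) (u v : Fin n) : Prop :=
  ∃ h : u ≠ v, ω ⟨s(u, v), by simpa [Sym2.mk_isDiag_iff] using h⟩ = true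

open Classical in
/-- The set of common neighbors of `S`. -/
noncomputable def commonNbrs {n : ℕ} (ω : EdgeCfg n) (S : Finset (Fin n)) : Finset (Fin n) :=
  Finset.univ.filter fun v => v ∉ S ∧ ∀ u ∈ S, Adj ω v u

/-- `S` is a face of the `m`-neighbor complex of the graph encoded by `ω`. -/
def IsFace {n : ℕ} (ω : EdgeCfg n) (m : ℕ) (S : Finset (Fin n)) : Prop :=
  m ≤ (commonNbrs ω S).card

open ProbabilityTheory

instance bern_isProbabilityMeasure {p : ℝ} [Fact (p ∈ Set.Icc (0 : ℝ) 1)] :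
    IsProbabilityMeasure (bern p) := by
  obtain ⟨h0, h1⟩ := Fact.out (p := p ∈ Set.Icc (0 : ℝ) 1)
  constructor
  simp only [bern, Measure.coe_add, Measure.coe_smul, Pi.add_apply, Pi.smul_apply, measure_univ,
    smul_eq_mul, mul_one]
  rw [← ENNReal.ofReal_add h0 (by linarith)]
  simp

instance erdosRenyi_isProbabilityMeasure {n : ℕ} {p : ℝ} [Fact (p ∈ Set.Icc (0 : ℝ) 1)] :
    IsProbabilityMeasure (erdosRenyi n p) := by
  unfold erdosRenyi
  infer_instance

lemma bern_singleton_true (p : ℝ) : bern p {true} = ENNReal.ofReal p := by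
  simp [bern]

lemma erdosRenyi_forall_mem_eq_true {n : ℕ} {p : ℝ} [Fact (p ∈ Set.Icc (0 : ℝ) 1)]
    (E : Finset {e : Sym2 (Fin n) // ¬ e.IsDiag}) :
    erdosRenyi n p {ω | ∀ e ∈ E, ω e = true} = ENNReal.ofReal p ^ E.card := by
  classical
  have h : {ω : EdgeCfg n | ∀ e ∈ E, ω e = true} =
      Set.pi Set.univ fun e ↦ if e ∈ E then {true} else Set.univ := by
    ext ω
    simp only [Set.mem_ofPred_eq, Set.mem_pi, Set.mem_univ, true_imp_iff]
    refine forall_congr' fun e ↦ ?_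
    split_ifs with he <;> simp [he]
  have hite (e : {e : Sym2 (Fin n) // ¬ e.IsDiag}) :
      bern p (if e ∈ E then {true} else Set.univ) = if e ∈ E then ENNReal.ofReal p else 1 := by
    split_ifs
    · exact bern_singleton_true p
    · exact measure_univ
  rw [h, erdosRenyi, Measure.pi_pi]
  simp_rw [hite]
  rw [Finset.prod_ite_mem, Finset.univ_inter, Finset.prod_const]

/-- The edges joining `v` to the vertices of `S`. -/
noncomputable def edgesTo {n : ℕ} (S : Finset (Fin n)) (v : {v // v ∉ S}) :
    Finset {e : Sym2 (Fin n) // ¬ e.IsDiag} :=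
  S.attach.image fun u ↦ ⟨s(v.1, u.1), by
    simpa [Sym2.mk_isDiag_iff] using fun h : v.1 = u.1 ↦ v.2 (h ▸ u.2)⟩

lemma card_edgesTo {n : ℕ} (S : Finset (Fin n)) (v : {v // v ∉ S}) :
    (edgesTo S v).card = S.card := by
  rw [edgesTo, Finset.card_image_of_injective, Finset.card_attach]
  intro a b h
  rw [Subtype.mk.injEq, Sym2.congr_right] at h
  exact Subtype.ext h

lemma pairwise_disjoint_edgesTo {n : ℕ} (S : Finset (Fin n)) :
    Pairwise (Function.onFun Disjoint (edgesTo S)) := by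
  intro v w hvw
  rw [Function.onFun, Finset.disjoint_left]
  intro e hv hw
  simp only [edgesTo, Finset.mem_image, Finset.mem_attach, true_and, Subtype.exists] at hv hw
  obtain ⟨a, ha, rfl⟩ := hv
  obtain ⟨b, hb, h⟩ := hw
  rw [Subtype.mk.injEq, Sym2.eq_iff] at h
  rcases h with h | h
  · exact hvw (Subtype.ext h.1.symm)
  · exact w.2 (h.1 ▸ ha)

/-- The event that `v` is a common neighbor of `S`. -/
def nbrEvent {n : ℕ} (S : Finset (Fin n)) (v : {v // v ∉ S}) : Set (EdgeCfg n) :=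
  {ω | ∀ e ∈ edgesTo S v, ω e = true}

lemma mem_commonNbrs {n : ℕ} {S : Finset (Fin n)} {v : Fin n} {ω : EdgeCfg n} :
    v ∈ commonNbrs ω S ↔ v ∉ S ∧ ∀ u ∈ S, Adj ω v u := by
  simp [commonNbrs]

lemma mem_nbrEvent {n : ℕ} {S : Finset (Fin n)} {v : {v // v ∉ S}} {ω : EdgeCfg n} :
    ω ∈ nbrEvent S v ↔ v.1 ∈ commonNbrs ω S := by
  simp only [nbrEvent, edgesTo, Set.mem_ofPred_eq, Finset.mem_image, Finset.mem_attach, true_and,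
    mem_commonNbrs]
  constructor
  · refine fun h ↦ ⟨v.2, fun u hu ↦ ?_⟩
    exact ⟨fun h ↦ v.2 (h ▸ hu), h _ ⟨⟨u, hu⟩, rfl⟩⟩
  · rintro h _ ⟨u, rfl⟩
    exact (h.2 u.1 u.2).2

lemma measurableSet_nbrEvent {n : ℕ} (S : Finset (Fin n)) (v : {v // v ∉ S}) :
    MeasurableSet (nbrEvent S v) :=
  (Set.toFinite _).measurableSet

lemma iIndepSet_nbrEvent {n : ℕ} {p : ℝ} [Fact (p ∈ Set.Icc (0 : ℝ) 1)] (S : Finset (Fin n)) :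
    iIndepSet (nbrEvent S) (erdosRenyi n p) := by
  rw [iIndepSet_iff_meas_biInter (measurableSet_nbrEvent S)]
  intro s
  have h : ⋂ v ∈ s, nbrEvent S v = {ω | ∀ e ∈ s.biUnion (edgesTo S), ω e = true} := by
    ext ω
    simp only [nbrEvent, Set.mem_iInter, Set.mem_ofPred_eq, Finset.mem_biUnion]
    grind
  rw [h, erdosRenyi_forall_mem_eq_true,
    Finset.card_biUnion fun v _ w _ hvw ↦ pairwise_disjoint_edgesTo S hvw,
    ← Finset.prod_pow_eq_pow_sum]
  exact Finset.prod_congr rfl fun v _ ↦ (erdosRenyi_forall_mem_eq_true _).symm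

lemma integral_indicator_nbrEvent {n : ℕ} {p : ℝ} [hp : Fact (p ∈ Set.Icc (0 : ℝ) 1)]
    (S : Finset (Fin n)) (v : {v // v ∉ S}) :
    ∫ ω, (nbrEvent S v).indicator (fun _ ↦ (1 : ℝ)) ω ∂erdosRenyi n p = p ^ S.card := by
  rw [integral_indicator_const _ (measurableSet_nbrEvent S v), measureReal_def, nbrEvent,
    erdosRenyi_forall_mem_eq_true, card_edgesTo, ENNReal.toReal_pow,
    ENNReal.toReal_ofReal hp.out.1, smul_eq_mul, mul_one]

lemma card_commonNbrs_eq_sum {n : ℕ} (S : Finset (Fin n)) (ω : EdgeCfg n) :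
    ((commonNbrs ω S).card : ℝ) =
      ∑ v : {v // v ∉ S}, (nbrEvent S v).indicator (fun _ ↦ (1 : ℝ)) ω := by
  classical
  simp only [Set.indicator_apply, mem_nbrEvent]
  rw [Finset.sum_boole, Nat.cast_inj]
  have h : commonNbrs ω S = (Finset.univ.filter
      fun v : {v // v ∉ S} ↦ v.1 ∈ commonNbrs ω S).map (Function.Embedding.subtype _) := by
    ext v
    simp only [Finset.mem_map, Finset.mem_filter, Finset.mem_univ, true_and,
      Function.Embedding.subtype_apply, Subtype.exists, exists_and_left, exists_prop,
      exists_eq_right_right]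
    simp +contextual [mem_commonNbrs]
  conv_lhs => rw [h]
  rw [Finset.card_map]

/-- Hoeffding's lower tail bound for the number of common neighbors. -/
lemma erdosRenyi_card_commonNbrs_le {n : ℕ} {p : ℝ} [Fact (p ∈ Set.Icc (0 : ℝ) 1)]
    (S : Finset (Fin n)) {ε : ℝ} (hε : 0 ≤ ε) :
    (erdosRenyi n p).real {ω | ((commonNbrs ω S).card : ℝ) ≤ (n - S.card) * p ^ S.card - ε} ≤
      Real.exp (-2 * ε ^ 2 / (n - S.card)) := by
  have hcard : (Fintype.card {v // v ∉ S} : ℝ) = n - S.card := by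
    rw [Fintype.card_subtype_compl, Fintype.card_coe, Fintype.card_fin,
      Nat.cast_sub (by simpa using S.card_le_univ)]
  have hind := ((iIndepSet_nbrEvent (p := p) S).iIndepFun_indicator (β := ℝ)).comp
    (fun _ x ↦ p ^ S.card - x) fun _ ↦ by fun_prop
  have hsub (v : {v // v ∉ S}) : HasSubgaussianMGF
      ((fun x : ℝ ↦ p ^ S.card - x) ∘ (nbrEvent S v).indicator fun _ ↦ (1 : ℝ))
      ((‖(1 : ℝ) - 0‖₊ / 2) ^ 2) (erdosRenyi n p) := by
    have h := (hasSubgaussianMGF_of_mem_Icc (μ := erdosRenyi n p) (a := 0) (b := 1)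
      (X := (nbrEvent S v).indicator fun _ ↦ (1 : ℝ))
      ((measurable_const.indicator (measurableSet_nbrEvent S v)).aemeasurable)
      (.of_forall fun ω ↦ ⟨Set.indicator_nonneg (by simp) _,
        Set.indicator_le_self' (by simp) _⟩)).neg
    rw [integral_indicator_nbrEvent] at h
    convert h using 1
    ext ω
    simp
  have h := HasSubgaussianMGF.measure_sum_ge_le_of_iIndepFun hind
    (s := Finset.univ) (fun v _ ↦ hsub v) hε
  convert h using 2
  · ext ω
    simp only [Set.mem_ofPred_eq, Function.comp_apply, Finset.sum_sub_distrib,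
      ← card_commonNbrs_eq_sum, Finset.sum_const, Finset.card_univ, nsmul_eq_mul, hcard]
    constructor <;> intro h <;> linarith
  · simp only [Finset.sum_const, Finset.card_univ, nsmul_eq_mul, sub_zero, nnnorm_one]
    push_cast
    rw [hcard, show 2 * (((n : ℝ) - S.card) * (1 / 2) ^ 2) = (n - S.card) / 2 by ring,
      div_div_eq_mul_div]
    ring

/-- Lemma 2 of the paper, case $p > 1/4$: there is $N$ (depending only on $p$) so that
for $n \ge N$, $1 \le m \le n$, $t \ge 1$ with $|t - \log_p(m/n)| \le 1/2$, any set of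
$t-1$ vertices fails to be a face of $N_m(G(n,p))$ with probability at most
$\exp(-(1/3)(p^{-1/2}-1)^2 m^2/n)$. -/
theorem stmt3 (p : ℝ) (hp0 : 1/4 < p) (hp1 : p < 1) :
    ∃ N : ℕ, ∀ n m t : ℕ, N ≤ n → 1 ≤ m → m ≤ n → 1 ≤ t →
      |(t : ℝ) - (Real.log m - Real.log n) / Real.log p| ≤ 1/2 →
      ∀ f : Finset (Fin n), f.card = t - 1 →
        erdosRenyi n p {ω | ¬ IsFace ω m f} ≤
          ENNReal.ofReal
            (Real.exp (-((1/3) * (p ^ (-(1/2) : ℝ) - 1)^2 * (m : ℝ)^2 / n))) := by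
  have hp : 0 < p := by linarith
  have : Fact (p ∈ Set.Icc (0 : ℝ) 1) := ⟨hp.le, hp1.le⟩
  set a := p ^ (-(1/2) : ℝ) with ha
  have ha1 : 1 < a := Real.one_lt_rpow_of_pos_of_lt_one_of_neg hp hp1 (by norm_num)
  have hlogp : Real.log p < 0 := Real.log_neg hp hp1
  -- `δ * n` bounds the size of the sets `f` under consideration
  set δ := (a - 1) / (2 * a) with hδ
  have hδ0 : 0 < δ := div_pos (by linarith) (by linarith)
  have hδa : δ * a = (a - 1) / 2 := by rw [hδ]; field_simp
  have hδ1 : δ < 1 := by nlinarith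
  obtain ⟨N, hN⟩ := Filter.eventually_atTop.1 <|
    (Real.isLittleO_log_id_atTop.comp_tendsto tendsto_natCast_atTop_atTop).bound
      (mul_pos hδ0 (neg_pos.2 hlogp))
  refine ⟨max N 1, fun n m t hn hm hmn ht habs f hf ↦ ?_⟩
  have hn0 : (0 : ℝ) < n := by exact_mod_cast (le_max_right N 1).trans hn
  have hm0 : (0 : ℝ) < m := by exact_mod_cast hm
  have hlogm : 0 ≤ Real.log m := Real.log_natCast_nonneg m
  have hk : (f.card : ℝ) = t - 1 := by rw [hf, Nat.cast_sub ht, Nat.cast_one]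
  have hlogn : Real.log n ≤ δ * -Real.log p * n := by
    have h := hN n ((le_max_left N 1).trans hn)
    simp only [Function.comp_apply, id, Real.norm_eq_abs, abs_of_pos hn0] at h
    exact (le_abs_self _).trans h
  obtain ⟨hlo, hhi⟩ := abs_le.1 habs
  have hcancel : (Real.log m - Real.log n) / Real.log p * Real.log p =
      Real.log m - Real.log n := div_mul_cancel₀ _ hlogp.ne
  have hkn : (f.card : ℝ) ≤ δ * n := by
    have h : (Real.log m - Real.log n) / Real.log p ≤ δ * n := by
      rw [div_le_iff_of_neg hlogp]
      linarith
    linarith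
  have hpk : m / n * a ≤ p ^ f.card := by
    rw [← Real.log_le_log_iff (by positivity) (by positivity), Real.log_mul (by positivity)
      (by positivity), Real.log_div hm0.ne' hn0.ne', Real.log_pow, ha, Real.log_rpow hp, hk]
    nlinarith
  set M : ℝ := n - f.card with hM
  have hMn : (1 - δ) * n ≤ M := by linarith
  have hM0 : 0 < M := lt_of_lt_of_le (mul_pos (by linarith) hn0) hMn
  have hε : (a - 1) / 2 * m ≤ M * p ^ f.card - m := by
    have h : (1 - δ) * n * (m / n * a) ≤ M * p ^ f.card := by gcongr
    have h' : (1 - δ) * n * (m / n * a) = (a - δ * a) * m := by field_simp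
    rw [h', hδa] at h
    linarith
  have hε0 : 0 ≤ (a - 1) / 2 * m := by nlinarith
  have hbound := erdosRenyi_card_commonNbrs_le (p := p) f hε0
  rw [← ofReal_measureReal]
  refine ENNReal.ofReal_le_ofReal <| (measureReal_mono fun ω hω ↦ ?_).trans <|
    hbound.trans <| Real.exp_le_exp.2 ?_
  · have h : ((commonNbrs ω f).card : ℝ) < m := by
      exact_mod_cast not_le.1 hω
    simp only [Set.mem_ofPred_eq]
    linarith
  · rw [neg_mul, neg_div, neg_le_neg_iff]
    have h : 1/3 * (a - 1) ^ 2 * (m : ℝ) ^ 2 ≤ 2 * ((a - 1) / 2 * m) ^ 2 := by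
      nlinarith [sq_nonneg ((a - 1) * m)]
    have hMle : M ≤ n := by simp [hM]
    gcongr
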